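/- Let u be C² on a domain D ⊆ ℝ^m (m ≥ 2) and λ ≠ 0 a real number. Then u satisfies Δu + λ²u = 0 on D if and only if for every x ∈ D, lim_{r→0⁺} (M°(u, ∂B_r(x)) − u(x))/r² = −λ² u(x)/(2m). -/

import Mathlib

open MeasureTheory Metric Filter Real
open scoped Topology ENNReal

noncomputable def sphereMean (m : ℕ) (u : EuclideanSpace ℝ (Fin m) → ℝ)
    (x : EuclideanSpace ℝ (Fin m)) (r : ℝ) : ℝ :=
  ⨍ y in sphere x r, u y ∂(μH[(m : ℝ) - 1])

noncomputable def lap (m : ℕ) (u : EuclideanSpace ℝ (Fin m) → ℝ)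
    (x : EuclideanSpace ℝ (Fin m)) : ℝ :=
  ∑ i : Fin m, fderiv ℝ (fun y => fderiv ℝ u y (EuclideanSpace.single i 1)) x
    (EuclideanSpace.single i 1)

lemma sphere_pos (n : ℕ) :
    0 < (μH[(n : ℝ)] : Measure (EuclideanSpace ℝ (Fin (n+1)))) (sphere 0 1) := by
  let f : EuclideanSpace ℝ (Fin (n+1)) → (Fin n → ℝ) := fun y j => y j.succ
  have hf : LipschitzWith 1 f := by
    refine LipschitzWith.of_dist_le_mul fun x y => ?_
    rw [NNReal.coe_one, one_mul, dist_pi_le_iff dist_nonneg]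
    intro j
    have := PiLp.norm_apply_le (x - y) j.succ
    simpa [f, dist_eq_norm] using this
  have h1 := hf.hausdorffMeasure_image_le (d := (n : ℝ)) (by positivity)
    (sphere (0 : EuclideanSpace ℝ (Fin (n+1))) 1)
  simp only [ENNReal.coe_one, ENNReal.one_rpow, one_mul] at h1
  refine lt_of_lt_of_le ?_ h1
  have h2 : (μH[(n : ℝ)] : Measure (Fin n → ℝ)) = volume := by
    have := hausdorffMeasure_pi_real (ι := Fin n)
    rwa [Fintype.card_fin] at this
  rw [h2]
  let U : Set (Fin n → ℝ) := {z | ∑ j, z j ^ 2 < 1}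
  have hU : IsOpen U := isOpen_lt (by fun_prop) (by fun_prop)
  have hU0 : U.Nonempty := ⟨0, by simp [U]⟩
  refine lt_of_lt_of_le (hU.measure_pos volume hU0) (measure_mono ?_)
  intro z hz
  refine ⟨WithLp.toLp 2 (Fin.cons (√(1 - ∑ j, z j ^ 2)) z), ?_, ?_⟩
  · have hz' : ∑ j, z j ^ 2 < 1 := hz
    rw [mem_sphere_zero_iff_norm, EuclideanSpace.norm_eq, Fin.sum_univ_succ]
    simp [Real.sq_sqrt (sub_nonneg.2 hz'.le)]
  · ext j; simp [f]

lemma sphere_lt_top (n : ℕ) :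
    (μH[(n : ℝ)] : Measure (EuclideanSpace ℝ (Fin (n+1)))) (sphere 0 1) < ∞ := by
  have h2 : (μH[(n : ℝ)] : Measure (Fin n → ℝ)) = volume := by
    have := hausdorffMeasure_pi_real (ι := Fin n)
    rwa [Fintype.card_fin] at this
  let w : Fin (n+1) → ℝ → (Fin n → ℝ) → EuclideanSpace ℝ (Fin (n+1)) :=
    fun i s z => WithLp.toLp 2 (i.insertNth s z)
  let g : Fin (n+1) → ℝ → (Fin n → ℝ) → EuclideanSpace ℝ (Fin (n+1)) :=
    fun i s z => ‖w i s z‖⁻¹ • w i s z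
  have hw0 : ∀ i s z, s ≠ 0 → w i s z ≠ 0 := by
    intro i s z hs h
    have : w i s z i = 0 := by rw [h]; rfl
    simp [w] at this
    exact hs this
  have hw : ∀ i s, ContDiff ℝ 1 (w i s) := by
    intro i s
    rw [contDiff_euclidean]
    intro j
    rcases Fin.eq_self_or_eq_succAbove i j with rfl | ⟨k, rfl⟩
    · simp [w]; fun_prop
    · simp [w]; fun_prop
  have hg : ∀ i s, s ≠ 0 → ContDiff ℝ 1 (g i s) := by
    intro i s hs
    have h := (hw i s).norm ℝ (fun z => hw0 i s z hs)
    exact (h.inv (fun z => norm_ne_zero_iff.2 (hw0 i s z hs))).smul (hw i s)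
  have hfin : ∀ i s, s ≠ 0 → (μH[(n : ℝ)] : Measure (EuclideanSpace ℝ (Fin (n+1))))
      (g i s '' (closedBall 0 1)) < ∞ := by
    intro i s hs
    obtain ⟨K, hK⟩ := ((hg i s hs).locallyLipschitz.locallyLipschitzOn
      (s := closedBall 0 1)).exists_lipschitzOnWith_of_compact (isCompact_closedBall _ _)
    refine (hK.hausdorffMeasure_image_le (d := (n:ℝ)) (by positivity)).trans_lt ?_
    rw [h2]
    exact ENNReal.mul_lt_top (ENNReal.rpow_lt_top_of_nonneg (by positivity) ENNReal.coe_ne_top)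
      (isCompact_closedBall _ _).measure_lt_top
  have hcov : sphere (0 : EuclideanSpace ℝ (Fin (n+1))) 1 ⊆
      ⋃ i, (g i 1 '' (closedBall 0 1) ∪ g i (-1) '' (closedBall 0 1)) := by
    intro y hy
    have hy1 : ‖y‖ = 1 := by simpa using hy
    obtain ⟨i, hi⟩ := Finite.exists_max (fun i => |y i|)
    have hpos : 0 < |y i| := by
      by_contra h
      have : y = 0 := by
        ext j
        have := (hi j).trans (not_lt.1 h)
        simpa using this
      simp [this] at hy1
    have key : ∀ s : ℝ, s * |y i| = y i → y ∈ g i s '' (closedBall 0 1) := by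
      intro s hs
      refine ⟨fun j => y (i.succAbove j) / |y i|, ?_, ?_⟩
      · rw [mem_closedBall_zero_iff, pi_norm_le_iff_of_nonneg zero_le_one]
        intro j
        rw [Real.norm_eq_abs, abs_div, abs_abs, div_le_one hpos]
        exact hi _
      · have : w i s (fun j => y (i.succAbove j) / |y i|) = |y i|⁻¹ • y := by
          ext j
          rcases Fin.eq_self_or_eq_succAbove i j with rfl | ⟨k, rfl⟩
          · simp only [w, PiLp.smul_apply, smul_eq_mul, Fin.insertNth_apply_same]
            field_simp
            linarith
          · simp only [w, PiLp.smul_apply, smul_eq_mul, Fin.insertNth_apply_succAbove]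
            ring
        simp only [g, this, norm_smul, hy1]
        rw [smul_smul]
        simp [hpos.ne']
    refine Set.mem_iUnion.2 ⟨i, ?_⟩
    rcases abs_cases (y i) with h | h
    · exact Or.inl (key 1 (by linarith))
    · exact Or.inr (key (-1) (by linarith))
  refine (measure_mono hcov).trans_lt ?_
  refine (measure_iUnion_le _).trans_lt ?_
  rw [tsum_fintype]
  refine ENNReal.sum_lt_top.2 fun i _ => ?_
  exact (measure_union_le _ _).trans_lt
    (ENNReal.add_lt_top.2 ⟨hfin i 1 one_ne_zero, hfin i (-1) (by norm_num)⟩)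

lemma taylor2 {E : Type*} [NormedAddCommGroup E] [NormedSpace ℝ E] {u : E → ℝ} {x : E}
    (hu : ContDiffAt ℝ 2 u x) {ε : ℝ} (hε : 0 < ε) :
    ∃ δ > 0, ∀ h : E, ‖h‖ < δ →
      ContinuousAt u (x + h) ∧
      |u (x + h) - u x - fderiv ℝ u x h - (1/2) * fderiv ℝ (fderiv ℝ u) x h h| ≤ ε * ‖h‖ ^ 2 := by
  have hsymm : IsSymmSndFDerivAt ℝ u x := hu.isSymmSndFDerivAt (by simp)
  have hd1 : ∀ᶠ y in 𝓝 x, DifferentiableAt ℝ u y := by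
    filter_upwards [hu.eventually (by simp)] with y hy
    exact hy.differentiableAt (by simp)
  have hd2 : HasFDerivAt (fderiv ℝ u) (fderiv ℝ (fderiv ℝ u) x) x :=
    ((hu.fderiv_right (m := 1) (by norm_num)).differentiableAt (by simp)).hasFDerivAt
  have hlo := hd2.isLittleO.def hε
  obtain ⟨δ, hδ, hball⟩ := Metric.eventually_nhds_iff_ball.1 (hd1.and hlo)
  refine ⟨δ, hδ, fun h hh => ?_⟩
  have hmem : ∀ k : E, ‖k‖ < δ → x + k ∈ ball x δ := by
    intro k hk; simpa [mem_ball, dist_eq_norm] using hk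
  refine ⟨(hball _ (hmem h hh)).1.continuousAt, ?_⟩
  set A := fderiv ℝ u x with hA
  set B := fderiv ℝ (fderiv ℝ u) x with hB
  let F : E → ℝ := fun k => u (x + k) - u x - A k - (1/2) * B k k
  have hF : ∀ k : E, ‖k‖ < δ →
      HasFDerivAt F (fderiv ℝ u (x + k) - A - B k) k := by
    intro k hk
    have h1 : HasFDerivAt (fun k => u (x + k)) (fderiv ℝ u (x + k)) k := by
      have := (hball _ (hmem k hk)).1.hasFDerivAt
      have h2 : HasFDerivAt (fun k : E => x + k) (ContinuousLinearMap.id ℝ E) k :=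
        (hasFDerivAt_id k).const_add x
      exact this.comp k h2
    have h3 : HasFDerivAt (fun k => B k k) (B k + B.flip k) k := by
      have := (B.hasFDerivAt (x := k)).clm_apply (hasFDerivAt_id k)
      exact this.congr_fderiv (by ext v; rfl)
    have h4 := ((h1.sub_const (u x)).sub A.hasFDerivAt).sub (h3.const_mul (1/2))
    refine h4.congr_fderiv ?_
    ext v
    have := hsymm k v
    rw [← hB] at this
    simp only [sub_apply, smul_apply,
      add_apply, ContinuousLinearMap.flip_apply,
      smul_eq_mul, this]
    ring
  have hmv := (convex_segment (0:E) h).norm_image_sub_le_of_norm_hasFDerivWithin_le (f := F)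
    (f' := fun k => fderiv ℝ u (x + k) - A - B k) (C := ε * ‖h‖) (x := 0) (y := h)
    ?_ ?_ (left_mem_segment ℝ _ _) (right_mem_segment ℝ _ _)
  · have h0 : F 0 = 0 := by simp [F]
    rw [h0, sub_zero, sub_zero, Real.norm_eq_abs] at hmv
    calc _ = |F h| := rfl
      _ ≤ _ := hmv
      _ = _ := by ring
  all_goals
    intro k hk
    have hkh : ‖k‖ ≤ ‖h‖ := by
      have := norm_sub_le_of_mem_segment hk
      simpa using this
    have hkd := hkh.trans_lt hh
  · exact (hF k hkd).hasFDerivWithinAt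
  · have := (hball _ (hmem k hkd)).2
    simp only [add_sub_cancel_left] at this
    exact this.trans (by gcongr)

lemma sphere_invariant (m : ℕ) (d : ℝ)
    (f : EuclideanSpace ℝ (Fin m) ≃ₗᵢ[ℝ] EuclideanSpace ℝ (Fin m))
    (g : EuclideanSpace ℝ (Fin m) → ℝ) :
    ∫ y in sphere 0 1, g (f y) ∂(μH[d]) = ∫ y in sphere 0 1, g y ∂(μH[d]) := by
  have h := (f.toIsometryEquiv.measurePreserving_hausdorffMeasure d).setIntegral_preimage_emb
    f.toHomeomorph.measurableEmbedding g (sphere 0 1)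
  have h2 : f.toIsometryEquiv ⁻¹' (sphere 0 1) = sphere 0 1 := by
    ext y; simp
  rw [h2] at h
  exact h

lemma sphere_integrable (m : ℕ) (d : ℝ)
    (hfin : (μH[d] : Measure (EuclideanSpace ℝ (Fin m))) (sphere 0 1) < ∞)
    (g : EuclideanSpace ℝ (Fin m) → ℝ) (hg : ContinuousOn g (sphere 0 1)) :
    IntegrableOn g (sphere 0 1) μH[d] := by
  exact hg.integrableOn_of_subset_isCompact (isCompact_sphere _ _)
    isClosed_sphere.measurableSet subset_rfl hfin.ne

lemma integral_linear (m : ℕ) (d : ℝ) (A : EuclideanSpace ℝ (Fin m) →L[ℝ] ℝ) :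
    ∫ y in sphere 0 1, A y ∂(μH[d]) = 0 := by
  have h := sphere_invariant m d (LinearIsometryEquiv.neg ℝ) A
  simp only [LinearIsometryEquiv.coe_neg, map_neg, integral_neg] at h
  linarith

lemma integral_offdiag (m : ℕ) (d : ℝ) (i j : Fin m) (hij : i ≠ j) :
    ∫ y in sphere (0 : EuclideanSpace ℝ (Fin m)) 1, y i * y j ∂(μH[d]) = 0 := by
  let f : EuclideanSpace ℝ (Fin m) ≃ₗᵢ[ℝ] EuclideanSpace ℝ (Fin m) :=
    LinearIsometryEquiv.piLpCongrRight 2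
      (fun k => if k = i then LinearIsometryEquiv.neg ℝ else LinearIsometryEquiv.refl ℝ ℝ)
  have h := sphere_invariant m d f (fun y => y i * y j)
  have h1 : ∀ y, f y i * f y j = -(y i * y j) := by
    intro y
    simp [f, hij.symm]
  simp only [h1, integral_neg] at h
  linarith

lemma integral_diag_eq (m : ℕ) (d : ℝ) (i j : Fin m) :
    ∫ y in sphere (0 : EuclideanSpace ℝ (Fin m)) 1, y i * y i ∂(μH[d]) =
    ∫ y in sphere (0 : EuclideanSpace ℝ (Fin m)) 1, y j * y j ∂(μH[d]) := by
  let f : EuclideanSpace ℝ (Fin m) ≃ₗᵢ[ℝ] EuclideanSpace ℝ (Fin m) :=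
    LinearIsometryEquiv.piLpCongrLeft 2 ℝ ℝ (Equiv.swap i j)
  have h := sphere_invariant m d f (fun y => y i * y i)
  have h1 : ∀ y, f y i * f y i = y j * y j := by
    intro y
    simp [f, LinearIsometryEquiv.piLpCongrLeft_apply, Equiv.piCongrLeft']
  simp only [h1] at h
  exact h.symm

lemma integral_diag (m : ℕ) (d : ℝ)
    (hfin : (μH[d] : Measure (EuclideanSpace ℝ (Fin m))) (sphere 0 1) < ∞) (i : Fin m) :
    m * ∫ y in sphere (0 : EuclideanSpace ℝ (Fin m)) 1, y i * y i ∂(μH[d]) =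
      (μH[d] : Measure (EuclideanSpace ℝ (Fin m))).real (sphere 0 1) := by
  have h : ∫ y in sphere (0 : EuclideanSpace ℝ (Fin m)) 1, ∑ j, y j * y j ∂(μH[d]) =
      (μH[d] : Measure (EuclideanSpace ℝ (Fin m))).real (sphere 0 1) := by
    rw [setIntegral_congr_fun (g := fun _ => (1:ℝ)) isClosed_sphere.measurableSet]
    · simp
    · intro y hy
      have hy1 : ‖y‖ = 1 := by simpa using hy
      have := EuclideanSpace.real_norm_sq_eq y
      rw [hy1] at this
      simp only [← sq]
      linarith
  rw [integral_finsetSum] at h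
  · rw [← h, Finset.sum_congr rfl (fun j _ => integral_diag_eq m d j i)]
    simp
  · intro j _
    exact sphere_integrable m d hfin _ (by fun_prop)

lemma integral_bilin (m : ℕ) (d : ℝ)
    (hfin : (μH[d] : Measure (EuclideanSpace ℝ (Fin m))) (sphere 0 1) < ∞)
    (B : EuclideanSpace ℝ (Fin m) →L[ℝ] EuclideanSpace ℝ (Fin m) →L[ℝ] ℝ) :
    m * ∫ y in sphere 0 1, B y y ∂(μH[d]) =
      (∑ i, B (EuclideanSpace.single i 1) (EuclideanSpace.single i 1)) *
      (μH[d] : Measure (EuclideanSpace ℝ (Fin m))).real (sphere 0 1) := by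
  have hB : ∀ y, B y y = ∑ i, ∑ j,
      B (EuclideanSpace.single i 1) (EuclideanSpace.single j 1) * (y i * y j) := by
    intro y
    have hy : y = ∑ i, y i • EuclideanSpace.single i (1:ℝ) := by
      ext k
      simp [Finset.sum_apply, Pi.single_apply]
    conv_lhs => rw [hy]
    simp only [map_sum, map_smul, sum_apply, smul_apply, smul_eq_mul,
      Finset.mul_sum]
    rw [Finset.sum_comm]
    refine Finset.sum_congr rfl fun i _ => Finset.sum_congr rfl fun j _ => ?_
    ring
  rw [integral_congr_ae (Eventually.of_forall hB)]
  have hint : ∀ i j : Fin m, IntegrableOn (fun y : EuclideanSpace ℝ (Fin m) =>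
      B (EuclideanSpace.single i 1) (EuclideanSpace.single j 1) * (y i * y j))
      (sphere 0 1) μH[d] :=
    fun i j => sphere_integrable m d hfin _ (by fun_prop)
  rw [integral_finsetSum _ (fun i _ => integrable_finsetSum _ (fun j _ => hint i j)),
    Finset.mul_sum, Finset.sum_mul]
  refine Finset.sum_congr rfl fun i _ => ?_
  rw [integral_finsetSum _ (fun j _ => hint i j), Finset.sum_eq_single i]
  · rw [integral_const_mul, ← integral_diag m d hfin i]; ring
  · intro j _ hj
    rw [integral_const_mul, integral_offdiag m d i j hj.symm, mul_zero]
  · simp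

open scoped Pointwise in
lemma sphere_scale (m : ℕ) (d : ℝ) (hd : 0 ≤ d) (x : EuclideanSpace ℝ (Fin m)) (r : ℝ)
    (hr : 0 < r) (u : EuclideanSpace ℝ (Fin m) → ℝ) :
    ∫ y in sphere x r, u y ∂(μH[d]) = r ^ d * ∫ y in sphere 0 1, u (x + r • y) ∂(μH[d]) := by
  let e : EuclideanSpace ℝ (Fin m) ≃ₜ EuclideanSpace ℝ (Fin m) :=
    (Homeomorph.smulOfNeZero r hr.ne').trans (Homeomorph.addLeft x)
  have he : ∀ y, e y = x + r • y := fun y => rfl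
  have hpre : e ⁻¹' (sphere x r) = sphere 0 1 := by
    ext y
    simp [he, norm_smul, abs_of_pos hr, hr.ne']
  have hmap : (μH[d]).restrict (sphere x r) =
      (ENNReal.ofReal (r ^ d)) • Measure.map e ((μH[d]).restrict (sphere 0 1)) := by
    rw [← hpre, ← e.measurableEmbedding.restrict_map, ← Measure.restrict_smul]
    congr 1
    ext s hs
    rw [Measure.smul_apply, e.measurableEmbedding.map_apply]
    have h1 := Measure.hausdorffMeasure_smul₀ hd hr.ne' (e ⁻¹' s)
    have h2 : s = (IsometryEquiv.addLeft x) '' (r • (e ⁻¹' s)) := by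
      ext z
      constructor
      · intro hz
        refine ⟨r • (e.symm z), Set.smul_mem_smul_set (by simpa using hz), ?_⟩
        exact e.apply_symm_apply z
      · rintro ⟨_, ⟨y, hy, rfl⟩, rfl⟩
        exact hy
    conv_lhs => rw [h2, IsometryEquiv.hausdorffMeasure_image, h1]
    rw [smul_eq_mul, ENNReal.smul_def, smul_eq_mul]
    congr 1
    rw [ENNReal.coe_rpow_of_nonneg _ hd, ← ENNReal.ofReal_rpow_of_pos hr]
    congr 1
    exact (Real.enorm_eq_ofReal hr.le)
  rw [hmap, integral_smul_measure, e.measurableEmbedding.integral_map,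
    ENNReal.toReal_ofReal (by positivity), smul_eq_mul]
  rfl

lemma lap_eq (m : ℕ) (u : EuclideanSpace ℝ (Fin m) → ℝ) (x : EuclideanSpace ℝ (Fin m))
    (hu : ContDiffAt ℝ 2 u x) :
    lap m u x = ∑ i, fderiv ℝ (fderiv ℝ u) x (EuclideanSpace.single i 1)
      (EuclideanSpace.single i 1) := by
  have hd2 : HasFDerivAt (fderiv ℝ u) (fderiv ℝ (fderiv ℝ u) x) x :=
    ((hu.fderiv_right (m := 1) (by norm_num)).differentiableAt (by simp)).hasFDerivAt
  refine Finset.sum_congr rfl fun i _ => ?_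
  have h := hd2.clm_apply (hasFDerivAt_const (EuclideanSpace.single i (1:ℝ)) x)
  rw [h.fderiv]
  simp

lemma mean_eq (m : ℕ) (hm : 2 ≤ m) (u : EuclideanSpace ℝ (Fin m) → ℝ)
    (x : EuclideanSpace ℝ (Fin m)) (r : ℝ) (hr : 0 < r) :
    sphereMean m u x r =
      ((μH[(m : ℝ) - 1] : Measure (EuclideanSpace ℝ (Fin m))).real (sphere 0 1))⁻¹ *
        ∫ y in sphere 0 1, u (x + r • y) ∂(μH[(m : ℝ) - 1]) := by
  have hd : (0 : ℝ) ≤ (m : ℝ) - 1 := by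
    have : (2 : ℝ) ≤ m := by exact_mod_cast hm
    linarith
  have h1 := sphere_scale m _ hd x r hr (fun _ => 1)
  simp only [integral_const, smul_eq_mul, mul_one, measureReal_restrict_apply_univ] at h1
  rw [sphereMean, setAverage_eq, sphere_scale m _ hd x r hr u, h1, smul_eq_mul]
  have : r ^ ((m : ℝ) - 1) ≠ 0 := (Real.rpow_pos_of_pos hr _).ne'
  rw [mul_inv, mul_mul_mul_comm, inv_mul_cancel₀ this, one_mul]

lemma limit_eq (m : ℕ) (hm : 2 ≤ m) (u : EuclideanSpace ℝ (Fin m) → ℝ)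
    (x : EuclideanSpace ℝ (Fin m)) (hu : ContDiffAt ℝ 2 u x) :
    Tendsto (fun r => (sphereMean m u x r - u x) / r ^ 2) (𝓝[>] 0)
        (𝓝 (lap m u x / (2 * m))) := by
  have hm0 : (0 : ℝ) < m := by positivity
  have hpos : 0 < (μH[(m : ℝ) - 1] : Measure (EuclideanSpace ℝ (Fin m))) (sphere 0 1) := by
    obtain ⟨n, rfl⟩ : ∃ n, m = n + 1 := ⟨m - 1, by omega⟩
    have := sphere_pos n
    rwa [Nat.cast_add, Nat.cast_one, add_sub_cancel_right]
  have hfin : (μH[(m : ℝ) - 1] : Measure (EuclideanSpace ℝ (Fin m))) (sphere 0 1) < ∞ := by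
    obtain ⟨n, rfl⟩ : ∃ n, m = n + 1 := ⟨m - 1, by omega⟩
    have := sphere_lt_top n
    rwa [Nat.cast_add, Nat.cast_one, add_sub_cancel_right]
  set μ : Measure (EuclideanSpace ℝ (Fin m)) := μH[(m : ℝ) - 1] with hμ
  set S : Set (EuclideanSpace ℝ (Fin m)) := sphere 0 1 with hS
  set M := μ.real S with hM
  have hM0 : 0 < M := ENNReal.toReal_pos hpos.ne' hfin.ne
  set A := fderiv ℝ u x with hA
  set B := fderiv ℝ (fderiv ℝ u) x with hB
  have hlap : lap m u x = _ := lap_eq m u x hu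
  have hBi : m * ∫ y in S, B y y ∂μ = lap m u x * M := by
    rw [hlap]; exact integral_bilin m _ hfin B
  have hAi : ∫ y in S, A y ∂μ = 0 := integral_linear m _ A
  rw [Metric.tendsto_nhds]
  intro ε hε
  obtain ⟨δ, hδ, hT⟩ := taylor2 hu (half_pos hε)
  filter_upwards [Ioo_mem_nhdsGT hδ] with r hr
  have hr0 : 0 < r := hr.1
  rw [mean_eq m hm u x r hr0]
  have hnorm : ∀ y ∈ S, ‖r • y‖ = r := by
    intro y hy
    have : ‖y‖ = 1 := by simpa [hS] using hy
    rw [norm_smul, this, Real.norm_of_nonneg hr0.le, mul_one]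
  have hcont : ContinuousOn (fun y => u (x + r • y)) S := by
    intro y hy
    have h1 := (hT (r • y) (by rw [hnorm y hy]; exact hr.2)).1
    exact (ContinuousAt.comp (f := fun y => x + r • y) (g := u) h1
      (by fun_prop)).continuousWithinAt
  have hi1 : IntegrableOn (fun y => u (x + r • y)) S μ := sphere_integrable m _ hfin _ hcont
  have hi2 : IntegrableOn (fun _ => u x) S μ := sphere_integrable m _ hfin _ (by fun_prop)
  have hi3 : IntegrableOn (fun y => r * A y) S μ := sphere_integrable m _ hfin _ (by fun_prop)
  have hi4 : IntegrableOn (fun y => (r ^ 2 / 2) * B y y) S μ :=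
    sphere_integrable m _ hfin _ (by fun_prop)
  have hR : ∫ y in S, (u (x + r • y) - u x - r * A y - (r ^ 2 / 2) * B y y) ∂μ =
      (∫ y in S, u (x + r • y) ∂μ) - M * u x - (r ^ 2 / 2) * ∫ y in S, B y y ∂μ := by
    have h12 : IntegrableOn (fun y => u (x + r • y) - u x) S μ := hi1.sub hi2
    have h123 : IntegrableOn (fun y => u (x + r • y) - u x - r * A y) S μ := h12.sub hi3
    rw [integral_sub h123 hi4, integral_sub h12 hi3,
      integral_sub hi1 hi2, integral_const_mul, integral_const_mul, hAi, integral_const]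
    simp [hM]
  have hbound : ‖∫ y in S, (u (x + r • y) - u x - r * A y - (r ^ 2 / 2) * B y y) ∂μ‖ ≤
      (ε / 2 * r ^ 2) * μ.real S := by
    refine norm_setIntegral_le_of_norm_le_const hfin ?_
    intro y hy
    have h1 := (hT (r • y) (by rw [hnorm y hy]; exact hr.2)).2
    rw [hnorm y hy] at h1
    rw [Real.norm_eq_abs]
    refine le_trans (le_of_eq ?_) h1
    congr 1
    simp only [map_smul, smul_apply, smul_eq_mul]
    ring
  rw [hR, ← hM, Real.norm_eq_abs] at hbound
  set I := ∫ y in S, u (x + r • y) ∂μ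
  set J := ∫ y in S, B y y ∂μ
  have hJ : J = lap m u x * M / m := by field_simp; linarith
  rw [Real.dist_eq]
  have hkey : (M⁻¹ * I - u x) / r ^ 2 - lap m u x / (2 * m) =
      (I - M * u x - r ^ 2 / 2 * J) / (M * r ^ 2) := by
    rw [hJ]; field_simp
  rw [hkey, abs_div, abs_of_pos (a := M * r ^ 2) (by positivity), div_lt_iff₀ (by positivity)]
  have : 0 < ε / 2 * (M * r ^ 2) := by positivity
  nlinarith

theorem stmt5 (m : ℕ) (hm : 2 ≤ m) (D : Set (EuclideanSpace ℝ (Fin m))) (hD : IsOpen D)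
    (u : EuclideanSpace ℝ (Fin m) → ℝ) (hu : ContDiffOn ℝ 2 u D) (hDc : IsConnected D) (l : ℝ) (hl : l ≠ 0) :
    (∀ x ∈ D, lap m u x + l ^ 2 * u x = 0) ↔
      ∀ x ∈ D, Tendsto (fun r => (sphereMean m u x r - u x) / r ^ 2) (𝓝[>] 0)
        (𝓝 (-(l ^ 2 * u x) / (2 * m))) := by
  have hm0 : (0 : ℝ) < m := by positivity
  refine forall₂_congr fun x hx => ?_
  have hlim := limit_eq m hm u x (hu.contDiffAt (hD.mem_nhds hx))
  constructor
  · intro h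
    have : lap m u x = -(l ^ 2 * u x) := by linarith
    rwa [this] at hlim
  · intro h
    have := tendsto_nhds_unique hlim h
    rw [div_left_inj' (by positivity)] at this
    linarith
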